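/- For every C > 0 there exist c > 0, δ > 0 and N such that the following holds for all n ≥ N and all integers k with |k − 2·log₂ n| ≤ C·log log n and C(n,k)·2^{−C(k,2)} ≤ n^{1+δ}. The probability that in G_{n,1/2} there exist disjoint (k+1)-element vertex sets A and B, each inducing at most k^{3/4} edges, together with an edge e induced by B, such that at most k^{2/3} vertices of A are adjacent to both endpoints of e, is at most e^{−ck}. -/

import Mathlib

open scoped Classical

/-- Probability of an event under the uniform measure on simple graphs on `Fin n`
(equivalently, `G_{n,1/2}`). -/
noncomputable def grPr (n : ℕ) (S : Set (SimpleGraph (Fin n))) : ℝ :=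
  ((PMF.uniformOfFintype (SimpleGraph (Fin n))).toOuterMeasure S).toReal

/-- Number of edges of `G` with both endpoints in `s`. -/
noncomputable def edgesIn {n : ℕ} (G : SimpleGraph (Fin n)) (s : Finset (Fin n)) : ℕ :=
  {e ∈ G.edgeSet | ∀ v ∈ e, v ∈ s}.ncard

/-- `E[Y_k] = C(n,k)·2^{-C(k,2)}`. -/
noncomputable def expY (n k : ℕ) : ℝ := (n.choose k : ℝ) / 2 ^ (k.choose 2)

open Finset

/-- The non-loop pairs with both endpoints in `s`. -/
noncomputable def innerPairs {n : ℕ} (s : Finset (Fin n)) : Finset (Sym2 (Fin n)) :=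
  s.sym2.filter fun e => ¬ e.IsDiag

lemma card_innerPairs {n : ℕ} (s : Finset (Fin n)) : (innerPairs s).card = s.card.choose 2 := by
  rw [← Sym2.card_image_offDiag]
  congr 1
  ext e
  induction e with | _ a b =>
  simp only [innerPairs, mem_filter, mk_mem_sym2_iff, Sym2.mk_isDiag_iff, mem_image, mem_offDiag,
    Prod.exists]
  constructor
  · rintro ⟨⟨h1, h2⟩, h3⟩
    exact ⟨a, b, ⟨h1, h2, h3⟩, rfl⟩
  · rintro ⟨x, y, ⟨h1, h2, h3⟩, h⟩
    rcases Sym2.eq_iff.1 h with ⟨rfl, rfl⟩ | ⟨rfl, rfl⟩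
    · exact ⟨⟨h1, h2⟩, h3⟩
    · exact ⟨⟨h2, h1⟩, Ne.symm h3⟩

lemma edgesIn_eq_card {n : ℕ} (G : SimpleGraph (Fin n)) (s : Finset (Fin n)) :
    edgesIn G s = ((innerPairs s).filter (· ∈ G.edgeSet)).card := by
  rw [edgesIn, ← Set.ncard_coe_finset]
  congr 1
  ext e
  simp only [Set.mem_ofPred_eq, innerPairs, coe_filter, mem_filter, mem_sym2_iff]
  constructor
  · rintro ⟨h1, h2⟩
    exact ⟨⟨h2, G.not_isDiag_of_mem_edgeSet h1⟩, h1⟩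
  · rintro ⟨⟨h2, -⟩, h1⟩
    exact ⟨h1, h2⟩

lemma card_powerset_filter_card_le {α : Type*} (s : Finset α) (t : ℕ) :
    (s.powerset.filter fun x => x.card ≤ t).card ≤ (s.card + 1) ^ t := by
  calc (s.powerset.filter fun x => x.card ≤ t).card
      ≤ ((range (t + 1)).biUnion fun i => s.powersetCard i).card := by
        apply card_le_card
        intro x hx
        simp only [mem_filter, mem_powerset, mem_biUnion, mem_range, mem_powersetCard] at hx ⊢
        exact ⟨_, Nat.lt_succ_of_le hx.2, hx.1, rfl⟩
    _ ≤ ∑ i ∈ range (t + 1), s.card.choose i := by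
        refine card_biUnion_le.trans (le_of_eq ?_)
        simp
    _ ≤ ∑ i ∈ range (t + 1), s.card ^ i * 1 ^ (t - i) * t.choose i := by
        apply sum_le_sum
        intro i hi
        rw [one_pow, mul_one]
        have h1 : 0 < t.choose i := Nat.choose_pos (Nat.lt_succ_iff.1 (mem_range.1 hi))
        exact (Nat.choose_le_pow _ _).trans (Nat.le_mul_of_pos_right _ h1)
    _ = (s.card + 1) ^ t := (add_pow _ _ _).symm

lemma grPr_eq {n : ℕ} (S : Set (SimpleGraph (Fin n))) :
    grPr n S = ((univ.filter (· ∈ S)).card : ℝ) / Fintype.card (SimpleGraph (Fin n)) := by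
  rw [grPr, PMF.toOuterMeasure_uniformOfFintype_apply, ENNReal.toReal_div]
  simp only [ENNReal.toReal_natCast]
  congr 2
  rw [Fintype.card_subtype]

/-- The pairs joining a vertex of `s` to `x`. -/
noncomputable def pairsTo {n : ℕ} (s : Finset (Fin n)) (x : Fin n) : Finset (Sym2 (Fin n)) :=
  s.image fun w => s(w, x)

lemma card_pairsTo {n : ℕ} (s : Finset (Fin n)) (x : Fin n) : (pairsTo s x).card = s.card :=
  card_image_of_injective _ fun _ _ h => Sym2.congr_left.1 h

/-- The pairs inside `A`, inside `B`, or joining `A` to `u` or `v`. -/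
noncomputable def relevantPairs {n : ℕ} (A B : Finset (Fin n)) (u v : Fin n) :
    Finset (Sym2 (Fin n)) :=
  innerPairs A ∪ innerPairs B ∪ (pairsTo A u ∪ pairsTo A v)

lemma card_relevantPairs {n : ℕ} {A B : Finset (Fin n)} {u v : Fin n} (hAB : Disjoint A B)
    (hu : u ∈ B) (hv : v ∈ B) (huv : u ≠ v) :
    (relevantPairs A B u v).card =
      A.card.choose 2 + B.card.choose 2 + (A.card + A.card) := by
  have huA : u ∉ A := fun h => disjoint_left.1 hAB h hu
  have hvA : v ∉ A := fun h => disjoint_left.1 hAB h hv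
  have key : ∀ {a b : Fin n}, a ∈ A → b ∈ B → a ≠ b := fun ha hb h =>
    disjoint_left.1 hAB ha (h ▸ hb)
  rw [relevantPairs, card_union_of_disjoint, card_union_of_disjoint, card_union_of_disjoint,
    card_innerPairs, card_innerPairs, card_pairsTo, card_pairsTo]
  · rw [disjoint_left]
    intro e h1 h2
    simp only [pairsTo, mem_image] at h1 h2
    obtain ⟨a, ha, rfl⟩ := h1
    obtain ⟨b, hb, h⟩ := h2
    rcases Sym2.eq_iff.1 h with ⟨-, h⟩ | ⟨h, -⟩
    · exact huv h.symm
    · exact huA (h ▸ hb)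
  · rw [disjoint_left]
    intro e
    induction e with | _ a b =>
    simp only [innerPairs, mem_filter, mk_mem_sym2_iff]
    rintro ⟨⟨h1, -⟩, -⟩ ⟨⟨h2, -⟩, -⟩
    exact key h1 h2 rfl
  · rw [disjoint_left]
    intro e h1 h2
    simp only [pairsTo, mem_image, mem_union] at h2
    simp only [innerPairs, mem_filter, mem_union] at h1
    rcases h2 with ⟨a, ha, rfl⟩ | ⟨a, ha, rfl⟩ <;> simp only [mk_mem_sym2_iff] at h1
    · rcases h1 with h1 | h1
      · exact huA h1.1.2
      · exact key ha h1.1.1 rfl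
    · rcases h1 with h1 | h1
      · exact hvA h1.1.2
      · exact key ha h1.1.1 rfl

/-- The graphs in which `A` and `B` induce at most `t` edges and at most `r` vertices of `A` are
adjacent to both `u` and `v`. -/
noncomputable def weakCoverGraphs {n : ℕ} (A B : Finset (Fin n)) (u v : Fin n) (t r : ℕ) :
    Finset (SimpleGraph (Fin n)) :=
  univ.filter fun G => edgesIn G A ≤ t ∧ edgesIn G B ≤ t ∧
    (A.filter fun w => G.Adj w u ∧ G.Adj w v).card ≤ r

lemma card_weakCoverGraphs_mul_le {n : ℕ} {A B : Finset (Fin n)} {u v : Fin n}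
    (hAB : Disjoint A B) (hu : u ∈ B) (hv : v ∈ B) (t r : ℕ) :
    (weakCoverGraphs A B u v t r).card * 2 ^ (relevantPairs A B u v).card ≤
      Fintype.card (SimpleGraph (Fin n)) *
        ((A.card.choose 2 + 1) ^ t * ((B.card.choose 2 + 1) ^ t *
          ((A.card + 1) ^ r * 3 ^ A.card))) := by
  have hne : ∀ a ∈ A, ∀ b ∈ B, a ≠ b := fun a ha b hb h => disjoint_left.1 hAB ha (h ▸ hb)
  set D := relevantPairs A B u v with hD
  have hDdiag : ∀ e ∈ D, ¬ e.IsDiag := by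
    intro e he
    simp only [hD, relevantPairs, innerPairs, pairsTo, mem_union, mem_filter, mem_image] at he
    rcases he with (h | h) | (⟨w, hw, rfl⟩ | ⟨w, hw, rfl⟩)
    · exact h.2
    · exact h.2
    · simpa using hne w hw u hu
    · simpa using hne w hw v hv
  let light (s : Finset (Fin n)) := (innerPairs s).powerset.filter fun x => x.card ≤ t
  let T : Finset (SimpleGraph (Fin n) × Finset (Sym2 (Fin n)) × Finset (Sym2 (Fin n)) ×
      Finset (Fin n) × (A → Fin 3)) :=
    univ ×ˢ light A ×ˢ light B ×ˢ (A.powerset.filter fun x => x.card ≤ r) ×ˢ univ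
  let f : SimpleGraph (Fin n) × Finset (Sym2 (Fin n)) → SimpleGraph (Fin n) ×
      Finset (Sym2 (Fin n)) × Finset (Sym2 (Fin n)) × Finset (Fin n) × (A → Fin 3) := fun p =>
    (SimpleGraph.fromEdgeSet ((p.1.edgeSet \ D) ∪ p.2),
      (innerPairs A).filter (· ∈ p.1.edgeSet), (innerPairs B).filter (· ∈ p.1.edgeSet),
      A.filter fun w => p.1.Adj w u ∧ p.1.Adj w v,
      fun w => if p.1.Adj w u ∧ ¬ p.1.Adj w v then 1 else
        if p.1.Adj w v ∧ ¬ p.1.Adj w u then 2 else 0)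
  have hT : T.card ≤ Fintype.card (SimpleGraph (Fin n)) *
        ((A.card.choose 2 + 1) ^ t * ((B.card.choose 2 + 1) ^ t *
          ((A.card + 1) ^ r * 3 ^ A.card))) := by
    simp only [T, card_product]
    gcongr
    · rfl
    · rw [← card_innerPairs]; exact card_powerset_filter_card_le _ _
    · rw [← card_innerPairs]; exact card_powerset_filter_card_le _ _
    · exact card_powerset_filter_card_le _ _
    · simp
  refine le_trans (le_of_eq ?_) ((card_le_card_of_injOn
    (s := weakCoverGraphs A B u v t r ×ˢ D.powerset) (t := T) f ?_ ?_).trans hT)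
  · rw [card_product, card_powerset]
  · rintro ⟨G, S⟩ h
    simp only [coe_product, Set.mem_prod, mem_coe, weakCoverGraphs, mem_filter, mem_univ,
      true_and, edgesIn_eq_card] at h
    simp only [f, T, light, coe_product, Set.mem_prod, mem_coe, mem_filter, mem_univ, true_and,
      mem_powerset, filter_subset, and_true]
    exact h.1
  · rintro ⟨G, S⟩ h ⟨G', S'⟩ h' hf
    simp only [coe_product, Set.mem_prod, mem_coe, mem_powerset] at h h'
    simp only [f, Prod.mk.injEq] at hf
    obtain ⟨h1, h2, h3, h4, h5⟩ := hf
    have hedge : ∀ e : Sym2 (Fin n), ¬ e.IsDiag →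
        ((e ∈ G.edgeSet ∧ e ∉ D ∨ e ∈ S) ↔ (e ∈ G'.edgeSet ∧ e ∉ D ∨ e ∈ S')) := by
      intro e he
      have := congrArg (fun H : SimpleGraph (Fin n) => e ∈ H.edgeSet) h1
      simpa [SimpleGraph.edgeSet_fromEdgeSet, he] using this
    have hw : ∀ w ∈ A, (G.Adj w u ↔ G'.Adj w u) ∧ (G.Adj w v ↔ G'.Adj w v) := by
      intro w hw
      have a := congrArg (fun x => w ∈ x) h4
      have b := congrFun h5 ⟨w, hw⟩
      simp only [mem_filter, hw, true_and] at a
      by_cases q1 : G.Adj w u <;> by_cases q2 : G.Adj w v <;> by_cases q3 : G'.Adj w u <;>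
        by_cases q4 : G'.Adj w v <;> simp_all
    have hmemD : ∀ e ∈ D, (e ∈ G.edgeSet ↔ e ∈ G'.edgeSet) := by
      intro e he
      simp only [hD, relevantPairs, pairsTo, mem_union, mem_image] at he
      rcases he with (h | h) | (⟨w, hw', rfl⟩ | ⟨w, hw', rfl⟩)
      · simpa [h] using congrArg (fun x => e ∈ x) h2
      · simpa [h] using congrArg (fun x => e ∈ x) h3
      · exact (hw w hw').1
      · exact (hw w hw').2
    have hG : G = G' := by
      apply SimpleGraph.edgeSet_injective
      ext e
      by_cases hd : e.IsDiag
      · exact ⟨fun q => absurd hd (G.not_isDiag_of_mem_edgeSet q),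
          fun q => absurd hd (G'.not_isDiag_of_mem_edgeSet q)⟩
      by_cases he : e ∈ D
      · exact hmemD e he
      · have a : e ∉ S := fun q => he (h.2 q)
        have b : e ∉ S' := fun q => he (h'.2 q)
        simpa [he, a, b] using hedge e hd
    have hS : S = S' := by
      ext e
      by_cases he : e ∈ D
      · simpa [he] using hedge e (hDdiag e he)
      · exact ⟨fun q => absurd (h.2 q) he, fun q => absurd (h'.2 q) he⟩
    rw [hG, hS]

lemma grPr_exists_weakCover_le (n k t r : ℕ) :
    grPr n {G | ∃ A B : Finset (Fin n), Disjoint A B ∧ A.card = k ∧ B.card = k ∧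
        ∃ u ∈ B, ∃ v ∈ B, u ≠ v ∧ G ∈ weakCoverGraphs A B u v t r} ≤
      expY n k ^ 2 * k ^ 2 * (((k.choose 2 : ℝ) + 1) ^ t) ^ 2 * (k + 1) ^ r * (3 / 4) ^ k := by
  have hSG : (0 : ℝ) < Fintype.card (SimpleGraph (Fin n)) := by exact_mod_cast Fintype.card_pos
  set K : ℝ := ((Fintype.card (SimpleGraph (Fin n)) : ℕ) : ℝ) with hK
  set Q : ℝ := (((k.choose 2 : ℝ) + 1) ^ t) ^ 2 * (k + 1) ^ r * 3 ^ k with hQ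
  set d : ℕ := k.choose 2 + k.choose 2 + (k + k) with hd
  let I : Finset (Finset (Fin n) × Finset (Fin n)) :=
    (powersetCard k univ ×ˢ powersetCard k univ).filter fun p => Disjoint p.1 p.2
  let J (p : Finset (Fin n) × Finset (Fin n)) : Finset (Fin n × Fin n) :=
    (p.2 ×ˢ p.2).filter fun q => q.1 ≠ q.2
  have hone : ∀ p ∈ I, ∀ q ∈ J p,
      ((weakCoverGraphs p.1 p.2 q.1 q.2 t r).card : ℝ) ≤ K * Q / 2 ^ d := by
    intro p hp q hq
    simp only [I, J, mem_filter, mem_product, mem_powersetCard_univ] at hp hq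
    obtain ⟨⟨hA, hB⟩, hAB⟩ := hp
    obtain ⟨⟨hu, hv⟩, huv⟩ := hq
    have h := card_weakCoverGraphs_mul_le hAB hu hv t r
    rw [card_relevantPairs hAB hu hv huv, hA, hB, ← hd] at h
    rw [le_div_iff₀ (by positivity)]
    have h' : ((weakCoverGraphs p.1 p.2 q.1 q.2 t r).card : ℝ) * 2 ^ d ≤
        K * (((k.choose 2 : ℝ) + 1) ^ t * (((k.choose 2 : ℝ) + 1) ^ t *
          (((k : ℝ) + 1) ^ r * 3 ^ k))) := by
      rw [hK]; exact_mod_cast h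
    refine h'.trans (le_of_eq ?_)
    rw [hQ]; ring
  have hJ : ∀ p ∈ I, ((J p).card : ℝ) ≤ k ^ 2 := by
    intro p hp
    simp only [I, mem_filter, mem_product, mem_powersetCard_univ] at hp
    have : (J p).card ≤ k * k := (card_filter_le _ _).trans (by rw [card_product, hp.1.2])
    rw [sq]; exact_mod_cast this
  have hI : (I.card : ℝ) ≤ (n.choose k : ℝ) ^ 2 := by
    have : I.card ≤ n.choose k * n.choose k :=
      (card_filter_le _ _).trans (by simp [card_product])
    rw [sq]; exact_mod_cast this
  rw [grPr_eq, div_le_iff₀ hSG]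
  calc _ ≤ (((I.biUnion fun p => (J p).biUnion fun q =>
          weakCoverGraphs p.1 p.2 q.1 q.2 t r).card : ℕ) : ℝ) := by
        gcongr
        intro G hG
        simp only [mem_filter, mem_univ, true_and, Set.mem_ofPred_eq] at hG
        obtain ⟨A, B, hAB, hA, hB, u, hu, v, hv, huv, h⟩ := hG
        simp only [mem_biUnion]
        exact ⟨(A, B), by simp [I, hA, hB, hAB], (u, v), by simp [J, hu, hv, huv], h⟩
    _ ≤ ∑ p ∈ I, ∑ q ∈ J p, ((weakCoverGraphs p.1 p.2 q.1 q.2 t r).card : ℝ) := by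
        exact_mod_cast card_biUnion_le.trans (sum_le_sum fun p _ => card_biUnion_le)
    _ ≤ ∑ p ∈ I, (k : ℝ) ^ 2 * (K * Q / 2 ^ d) := by
        refine sum_le_sum fun p hp => ?_
        refine (sum_le_card_nsmul _ _ _ (hone p hp)).trans ?_
        rw [nsmul_eq_mul]
        have := hJ p hp
        gcongr
    _ ≤ (n.choose k : ℝ) ^ 2 * ((k : ℝ) ^ 2 * (K * Q / 2 ^ d)) := by
        rw [sum_const, nsmul_eq_mul]
        gcongr
    _ = _ := by
        have h4 : (2 : ℝ) ^ (k + k) = 4 ^ k := by rw [← two_mul, pow_mul]; norm_num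
        rw [hQ, hd, expY, pow_add, pow_add, h4, div_pow, div_pow]
        field_simp

lemma expY_nonneg (n k : ℕ) : 0 ≤ expY n k := by unfold expY; positivity

lemma expY_succ_le (n k : ℕ) : expY n (k + 1) ≤ expY n k * (n / 2 ^ k) := by
  have h : n.choose (k + 1) ≤ n.choose k * n := by
    calc n.choose (k + 1) ≤ n.choose (k + 1) * (k + 1) := Nat.le_mul_of_pos_right _ k.succ_pos
      _ = n.choose k * (n - k) := Nat.choose_succ_right_eq n k
      _ ≤ n.choose k * n := Nat.mul_le_mul_left _ (Nat.sub_le _ _)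
  have h2 : (k + 1).choose 2 = k.choose 2 + k := by
    rw [Nat.choose_succ_succ' k 1, Nat.choose_one_right, add_comm]
  rw [expY, expY, h2, pow_add, div_mul_div_comm]
  gcongr
  exact_mod_cast h

lemma choose_two_succ_le (k : ℕ) : ((k + 1).choose 2 : ℝ) + 1 ≤ (k + 2) ^ 2 := by
  have h : (k + 1).choose 2 ≤ (k + 1) ^ 2 := Nat.choose_le_pow _ _
  have : ((k + 1).choose 2 : ℝ) ≤ (k + 1) ^ 2 := by exact_mod_cast h
  nlinarith [(Nat.cast_nonneg k : (0 : ℝ) ≤ k)]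

lemma grPr_exists_weakCover_succ_le {n k : ℕ} (hn : 1 ≤ n) {δ : ℝ}
    (hY : expY n k ≤ (n : ℝ) ^ (1 + δ)) (t r : ℕ) :
    grPr n {G | ∃ A B : Finset (Fin n), Disjoint A B ∧ A.card = k + 1 ∧ B.card = k + 1 ∧
        ∃ u ∈ B, ∃ v ∈ B, u ≠ v ∧ G ∈ weakCoverGraphs A B u v t r} ≤
      Real.exp (2 * (2 + δ) * Real.log n - 2 * k * Real.log 2 +
        (2 + 4 * t + r) * Real.log (k + 2) - (k + 1) * (2 * Real.log 2 - Real.log 3)) := by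
  have hn' : (0 : ℝ) < n := by exact_mod_cast hn
  have h1 : expY n (k + 1) ≤ Real.exp ((2 + δ) * Real.log n - k * Real.log 2) := by
    calc expY n (k + 1) ≤ (n : ℝ) ^ (1 + δ) * (n / 2 ^ k) :=
          (expY_succ_le n k).trans (by gcongr)
      _ = _ := by
          rw [Real.rpow_def_of_pos hn', Real.exp_sub, ← Real.log_pow, Real.exp_log (by positivity),
            show (2 + δ) * Real.log n = Real.log n * (1 + δ) + Real.log n by ring, Real.exp_add,
            Real.exp_log hn']
          ring
  have h34 : Real.exp (-(2 * Real.log 2 - Real.log 3)) = 3 / 4 := by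
    rw [show -(2 * Real.log 2 - Real.log 3) = Real.log 3 - (Real.log 2 + Real.log 2) by ring,
      Real.exp_sub, Real.exp_add, Real.exp_log (by norm_num), Real.exp_log (by norm_num)]
    norm_num
  have h0 := expY_nonneg n (k + 1)
  refine (grPr_exists_weakCover_le n (k + 1) t r).trans ?_
  calc _ ≤ Real.exp ((2 + δ) * Real.log n - k * Real.log 2) ^ 2 * (k + 2 : ℝ) ^ 2 *
          (((k + 2 : ℝ) ^ 2) ^ t) ^ 2 * (k + 2) ^ r * (3 / 4) ^ (k + 1) := by
        have hc := choose_two_succ_le k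
        push_cast
        rw [show (k : ℝ) + 1 + 1 = k + 2 by ring]
        gcongr
        norm_num
    _ = Real.exp ((2 + δ) * Real.log n - k * Real.log 2) ^ 2 * (k + 2 : ℝ) ^ (2 + 4 * t + r) *
          (3 / 4) ^ (k + 1) := by
        rw [← pow_mul, ← pow_mul, show 2 * (t * 2) = 4 * t by ring]
        ring
    _ = _ := by
        have hk : Real.exp (Real.log (k + 2)) = (k + 2 : ℝ) := Real.exp_log (by positivity)
        rw [← h34, show (k + 2 : ℝ) ^ (2 + 4 * t + r) =
          Real.exp (Real.log (k + 2)) ^ (2 + 4 * t + r) by rw [hk]]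
        rw [← Real.exp_nat_mul, ← Real.exp_nat_mul, ← Real.exp_nat_mul, ← Real.exp_add,
          ← Real.exp_add]
        congr 1
        push_cast
        ring

lemma eventually_rpow_mul_log_le :
    ∀ᶠ y : ℝ in Filter.atTop,
      (2 + 4 * y ^ (3 / 4 : ℝ) + y ^ (2 / 3 : ℝ)) * Real.log (y + 2) ≤ y / 100 := by
  have h := (isLittleO_log_rpow_atTop (r := 1 / 4) (by norm_num)).bound
    (show (0 : ℝ) < 1 / 1400 by norm_num)
  filter_upwards [h, Filter.eventually_ge_atTop 2] with y hy hy2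
  have hy0 : 0 < y := by linarith
  have hlog : 0 ≤ Real.log y := Real.log_nonneg (by linarith)
  rw [Real.norm_of_nonneg hlog, Real.norm_of_nonneg (by positivity)] at hy
  have h1 : Real.log (y + 2) ≤ 2 * Real.log y := by
    rw [← Nat.cast_ofNat (R := ℝ) (n := 2), ← Real.log_pow]
    apply Real.log_le_log (by positivity)
    push_cast
    nlinarith
  have h2 : (1 : ℝ) ≤ y ^ (3 / 4 : ℝ) := Real.one_le_rpow (by linarith) (by norm_num)
  have h3 : y ^ (2 / 3 : ℝ) ≤ y ^ (3 / 4 : ℝ) :=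
    Real.rpow_le_rpow_of_exponent_le (by linarith) (by norm_num)
  have h4 : y ^ (3 / 4 : ℝ) * y ^ (1 / 4 : ℝ) = y := by
    rw [← Real.rpow_add hy0]; norm_num
  calc _ ≤ (7 * y ^ (3 / 4 : ℝ)) * (2 * (1 / 1400 * y ^ (1 / 4 : ℝ))) := by
        apply mul_le_mul
        · linarith
        · linarith
        · exact Real.log_nonneg (by linarith)
        · positivity
    _ = (y ^ (3 / 4 : ℝ) * y ^ (1 / 4 : ℝ)) / 100 := by ring
    _ = y / 100 := by rw [h4]

lemma grPr_mono {n : ℕ} {S T : Set (SimpleGraph (Fin n))} (h : S ⊆ T) : grPr n S ≤ grPr n T := by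
  rw [grPr_eq, grPr_eq]
  gcongr

theorem stmt17 (C : ℝ) (hC : 0 < C) :
    ∃ c : ℝ, 0 < c ∧ ∃ δ : ℝ, 0 < δ ∧ ∃ N : ℕ, ∀ n : ℕ, N ≤ n → ∀ k : ℕ,
      |(k : ℝ) - 2 * Real.logb 2 n| ≤ C * Real.log (Real.log n) →
      expY n k ≤ (n : ℝ) ^ (1 + δ) →
      grPr n {G | ∃ A B : Finset (Fin n), Disjoint A B ∧
          A.card = k + 1 ∧ B.card = k + 1 ∧
          (edgesIn G A : ℝ) ≤ (k : ℝ) ^ (3 / 4 : ℝ) ∧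
          (edgesIn G B : ℝ) ≤ (k : ℝ) ^ (3 / 4 : ℝ) ∧
          ∃ u ∈ B, ∃ v ∈ B, G.Adj u v ∧
            ((A.filter (fun w => G.Adj w u ∧ G.Adj w v)).card : ℝ) ≤
              (k : ℝ) ^ (2 / 3 : ℝ)} ≤
        Real.exp (-c * k) := by
  obtain ⟨Y, hY⟩ := Filter.eventually_atTop.1 eventually_rpow_mul_log_le
  have hlogn : Filter.Tendsto (fun n : ℕ => Real.log n) Filter.atTop Filter.atTop :=
    Real.tendsto_log_atTop.comp tendsto_natCast_atTop_atTop
  have hsmall := hlogn.eventually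
    (Real.isLittleO_log_id_atTop.bound (show (0 : ℝ) < 1 / (100 * C) by positivity))
  obtain ⟨N, hN⟩ := Filter.eventually_atTop.1
    ((hsmall.and (hlogn.eventually_ge_atTop (max Y 1))).and (Filter.eventually_ge_atTop 1))
  refine ⟨1 / 10, by norm_num, 1 / 10, by norm_num, N, fun n hn k hk hexp => ?_⟩
  obtain ⟨⟨hs, hl⟩, hn1⟩ := hN n hn
  set L := Real.log n with hL
  have hL1 : 1 ≤ L := (le_max_right _ _).trans hl
  have hCL : C * Real.log L ≤ L / 100 := by
    rw [Real.norm_of_nonneg (Real.log_nonneg hL1), id, Real.norm_of_nonneg (by linarith)] at hs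
    calc C * Real.log L ≤ C * (1 / (100 * C) * L) := by gcongr
      _ = L / 100 := by field_simp
  have l2 := Real.log_two_gt_d9
  have l2' := Real.log_two_lt_d9
  have l3 := Real.log_three_lt_d9
  rw [Real.logb, ← hL] at hk
  obtain ⟨hk1, hk2⟩ := abs_le.1 hk
  set b := L / Real.log 2 with hb
  have hLb : L = b * Real.log 2 := by rw [hb]; field_simp
  have hbL : L ≤ b := by rw [hb, le_div_iff₀ (by linarith)]; nlinarith
  have hkL : L ≤ k := by linarith
  have hkY := hY k (((le_max_left _ _).trans hl).trans hkL)
  set t := ⌊(k : ℝ) ^ (3 / 4 : ℝ)⌋₊ with ht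
  set r := ⌊(k : ℝ) ^ (2 / 3 : ℝ)⌋₊ with hr
  have ht' : (t : ℝ) ≤ (k : ℝ) ^ (3 / 4 : ℝ) := Nat.floor_le (by positivity)
  have hr' : (r : ℝ) ≤ (k : ℝ) ^ (2 / 3 : ℝ) := Nat.floor_le (by positivity)
  have hsub : {G : SimpleGraph (Fin n) | ∃ A B : Finset (Fin n), Disjoint A B ∧
          A.card = k + 1 ∧ B.card = k + 1 ∧
          (edgesIn G A : ℝ) ≤ (k : ℝ) ^ (3 / 4 : ℝ) ∧
          (edgesIn G B : ℝ) ≤ (k : ℝ) ^ (3 / 4 : ℝ) ∧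
          ∃ u ∈ B, ∃ v ∈ B, G.Adj u v ∧
            ((A.filter (fun w => G.Adj w u ∧ G.Adj w v)).card : ℝ) ≤
              (k : ℝ) ^ (2 / 3 : ℝ)} ⊆
      {G | ∃ A B : Finset (Fin n), Disjoint A B ∧ A.card = k + 1 ∧ B.card = k + 1 ∧
        ∃ u ∈ B, ∃ v ∈ B, u ≠ v ∧ G ∈ weakCoverGraphs A B u v t r} := by
    rintro G ⟨A, B, hAB, hA, hB, hlA, hlB, u, hu, v, hv, huv, hw⟩
    refine ⟨A, B, hAB, hA, hB, u, hu, v, hv, huv.ne, ?_⟩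
    simp only [weakCoverGraphs, mem_filter, mem_univ, true_and]
    exact ⟨Nat.le_floor hlA, Nat.le_floor hlB, Nat.le_floor hw⟩
  refine (grPr_mono hsub).trans
    ((grPr_exists_weakCover_succ_le hn1 hexp t r).trans (Real.exp_le_exp.2 ?_))
  have hA : (2 + 4 * t + r) * Real.log (k + 2) ≤ (k : ℝ) / 100 := by
    refine le_trans ?_ hkY
    have : 0 ≤ Real.log ((k : ℝ) + 2) := Real.log_nonneg (by linarith)
    gcongr
  have hB : 2 * (2 + 1 / 10) * L - 2 * k * Real.log 2 ≤ 13 / 100 * k * Real.log 2 := by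
    have : 2 * b ≤ 101 / 100 * k := by linarith
    rw [hLb]
    nlinarith
  rw [← hL]
  nlinarith
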